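/- There exists a finite simple graph G on at most 2×10⁶ vertices with girth at least 6 and fractional chromatic number χ_f(G) ≥ 3.1. -/

import Mathlib

open Finset

/-- First moment method for a random subset `A` of `E` containing each element independently with
probability `p`: some `A` contains fewer than `X` of the sets `S i` and meets all the `T j`. -/
lemma exists_finset_few_subset_forall_not_disjoint {E ι κ : Type*} [Fintype E] [DecidableEq E]
    (p : ℝ) (hp0 : 0 ≤ p) (hp1 : p ≤ 1) (C : Finset ι) (S : ι → Finset E)
    (I : Finset κ) (T : κ → Finset E) (X : ℕ) (hX : 0 < X)
    (h : (∑ i ∈ C, p ^ #(S i)) / X + ∑ j ∈ I, (1 - p) ^ #(T j) < 1) :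
    ∃ A : Finset E, #{i ∈ C | S i ⊆ A} < X ∧ ∀ j ∈ I, ¬ Disjoint (T j) A := by
  by_contra! hcon
  set w : Finset E → ℝ := fun A => (∏ _e ∈ A, p) * ∏ _e ∈ Aᶜ, (1 - p) with hw
  have hw0 : ∀ A, 0 ≤ w A := fun A =>
    mul_nonneg (prod_nonneg fun _ _ => hp0) (prod_nonneg fun _ _ => sub_nonneg.2 hp1)
  have hw1 : ∑ A, w A = 1 := by
    rw [hw, ← Fintype.prod_add]
    simp
  have hS : ∀ B : Finset E, ∑ A, (if B ⊆ A then w A else 0) = p ^ #B := by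
    intro B
    have h1 := Fintype.prod_add (fun _ : E => p) (fun e => if e ∈ B then 0 else 1 - p)
    have h2 : ∏ e : E, (p + if e ∈ B then 0 else 1 - p) = p ^ #B := by
      rw [← prod_const, ← Fintype.prod_ite_mem B fun _ => p]
      refine prod_congr rfl fun e _ => ?_
      split_ifs <;> ring
    rw [← h2, h1]
    refine sum_congr rfl fun A _ => ?_
    split_ifs with hBA
    · simp only [hw]
      congr 1
      refine prod_congr rfl fun e he => ?_
      rw [if_neg fun heB => mem_compl.1 he (hBA heB)]
    · obtain ⟨e, heB, heA⟩ := not_subset.1 hBA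
      symm
      apply mul_eq_zero_of_right
      exact prod_eq_zero (mem_compl.2 heA) (if_pos heB)
  have hT : ∀ B : Finset E, ∑ A, (if Disjoint B A then w A else 0) = (1 - p) ^ #B := by
    intro B
    have h1 := Fintype.prod_add (fun e : E => if e ∈ B then 0 else p) (fun _ => 1 - p)
    have h2 : ∏ e : E, ((if e ∈ B then 0 else p) + (1 - p)) = (1 - p) ^ #B := by
      rw [← prod_const, ← Fintype.prod_ite_mem B fun _ => 1 - p]
      refine prod_congr rfl fun e _ => ?_
      split_ifs <;> ring
    rw [← h2, h1]
    refine sum_congr rfl fun A _ => ?_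
    split_ifs with hBA
    · simp only [hw]
      congr 1
      refine prod_congr rfl fun e he => ?_
      rw [if_neg fun heB => disjoint_left.1 hBA heB he]
    · obtain ⟨e, heB, heA⟩ := not_disjoint_iff.1 hBA
      symm
      apply mul_eq_zero_of_left
      exact prod_eq_zero heA (if_pos heB)
  have hX' : (0 : ℝ) < X := by exact_mod_cast hX
  have key : ∑ A, w A ≤ ∑ A, ((∑ i ∈ C, if S i ⊆ A then w A else 0) / X
      + ∑ j ∈ I, if Disjoint (T j) A then w A else 0) := by
    refine sum_le_sum fun A _ => ?_
    have hn1 : 0 ≤ ∑ i ∈ C, if S i ⊆ A then w A else 0 :=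
      sum_nonneg fun i _ => by split_ifs <;> simp [hw0]
    have hn2 : ∀ j ∈ I, 0 ≤ if Disjoint (T j) A then w A else 0 :=
      fun j _ => by split_ifs <;> simp [hw0]
    by_cases hA : #{i ∈ C | S i ⊆ A} < X
    · obtain ⟨j, hj, hd⟩ := hcon A hA
      have := single_le_sum hn2 hj
      rw [if_pos hd] at this
      have := div_nonneg hn1 hX'.le
      linarith
    · have h1 : (X : ℝ) ≤ #{i ∈ C | S i ⊆ A} := by exact_mod_cast not_lt.1 hA
      have h2 : w A ≤ (∑ i ∈ C, if S i ⊆ A then w A else 0) / X := by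
        rw [le_div_iff₀ hX', ← sum_filter, sum_const, nsmul_eq_mul, mul_comm]
        exact mul_le_mul_of_nonneg_right h1 (hw0 A)
      have := sum_nonneg hn2
      linarith
  rw [hw1, sum_add_distrib, ← sum_div, sum_comm, sum_comm (t := I)] at key
  simp only [hS, hT] at key
  linarith

/-- A graph on a linear order has girth at least six if it has no cycle of length three, four or
five, each written starting at its largest vertex and oriented towards the smaller neighbour. -/
lemma six_le_egirth_of_forall_max {V : Type*} [LinearOrder V] (G : SimpleGraph V)
    (h3 : ∀ v a b, a < v → b < v → a < b → G.Adj v a → G.Adj a b → G.Adj b v → False)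
    (h4 : ∀ v a c b, a < v → c < v → b < v → a < b → c ≠ a → c ≠ b →
      G.Adj v a → G.Adj a c → G.Adj c b → G.Adj b v → False)
    (h5 : ∀ v a c d b, a < v → c < v → d < v → b < v → a < b → c ≠ a → d ≠ a → c ≠ d →
      c ≠ b → d ≠ b →
      G.Adj v a → G.Adj a c → G.Adj c d → G.Adj d b → G.Adj b v → False) :
    6 ≤ G.egirth := by
  classical
  rw [SimpleGraph.le_egirth]
  intro u w₀ hw₀
  obtain ⟨v, hv, hmax⟩ := w₀.support.toFinset.exists_max_image id ⟨u, by simp⟩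
  rw [List.mem_toFinset] at hv
  rw [← SimpleGraph.Walk.length_rotate w₀ v hv]
  have hw := (SimpleGraph.Walk.isCycle_rotate hv).2 hw₀
  have hle : ∀ x ∈ (w₀.rotate v hv).support, x ≤ v := fun x hx =>
    hmax x (List.mem_toFinset.2 ((SimpleGraph.Walk.mem_support_rotate_iff w₀ v hv).1 hx))
  generalize w₀.rotate v hv = w at hw hle
  by_contra! hlt
  have hlt : w.length < 6 := by exact_mod_cast hlt
  have hnd := hw.support_nodup
  have h3l := hw.three_le_length
  match w with
  | .nil => simp at h3l
  | .cons _ .nil => simp at h3l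
  | .cons _ (.cons _ .nil) => simp at h3l
  | .cons (v := a) e1 (.cons (v := b) e2 (.cons e3 .nil)) =>
    simp at hle hnd
    have ha : a < v := lt_of_le_of_ne (by tauto) (by tauto)
    have hb : b < v := lt_of_le_of_ne (by tauto) (by tauto)
    rcases lt_or_gt_of_ne e2.ne with h | h
    · exact h3 v a b ha hb h e1 e2 e3
    · exact h3 v b a hb ha h e3.symm e2.symm e1.symm
  | .cons (v := a) e1 (.cons (v := c) e2 (.cons (v := b) e3 (.cons e4 .nil))) =>
    simp at hle hnd
    have ha : a < v := lt_of_le_of_ne (by tauto) (by tauto)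
    have hb : b < v := lt_of_le_of_ne (by tauto) (by tauto)
    have hc : c < v := lt_of_le_of_ne (by tauto) (by tauto)
    have hab : a ≠ b := by tauto
    rcases lt_or_gt_of_ne hab with h | h
    · exact h4 v a c b ha hc hb h e2.ne' e3.ne e1 e2 e3 e4
    · exact h4 v b c a hb hc ha h e3.ne e2.ne' e4.symm e3.symm e2.symm e1.symm
  | .cons (v := a) e1 (.cons (v := c) e2 (.cons (v := d) e3 (.cons (v := b) e4
      (.cons e5 .nil)))) =>
    simp at hle hnd
    have ha : a < v := lt_of_le_of_ne (by tauto) (by tauto)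
    have hb : b < v := lt_of_le_of_ne (by tauto) (by tauto)
    have hc : c < v := lt_of_le_of_ne (by tauto) (by tauto)
    have hd : d < v := lt_of_le_of_ne (by tauto) (by tauto)
    have hab : a ≠ b := by tauto
    have hcb : c ≠ b := by tauto
    have hda : d ≠ a := fun h => by subst h; tauto
    rcases lt_or_gt_of_ne hab with h | h
    · exact h5 v a c d b ha hc hd hb h e2.ne' hda e3.ne hcb e4.ne e1 e2 e3 e4 e5
    · exact h5 v b d c a hb hd hc ha h e4.ne hcb e3.ne' hda e2.ne'
        e5.symm e4.symm e3.symm e2.symm e1.symm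
  | .cons _ (.cons _ (.cons _ (.cons _ (.cons _ (.cons _ _))))) =>
    simp at hlt
    omega

/-- The pairs `a < b` of elements below `v`. -/
def ltPairsBelow {n : ℕ} (v : Fin n) : Finset (Fin n × Fin n) :=
  {x ∈ Iio v ×ˢ Iio v | x.1 < x.2}

lemma two_mul_card_ltPairsBelow_le {n : ℕ} (v : Fin n) :
    2 * #(ltPairsBelow v) ≤ (v : ℕ) ^ 2 := by
  have hswap : #{x ∈ Iio v ×ˢ Iio v | x.2 < x.1} = #(ltPairsBelow v) :=
    card_bij (fun x _ => x.swap) (by simp [ltPairsBelow]; tauto) (by simp)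
      (fun y hy => ⟨y.swap, by simp [ltPairsBelow] at hy ⊢; tauto, by simp⟩)
  have hdisj : Disjoint (ltPairsBelow v) {x ∈ Iio v ×ˢ Iio v | x.2 < x.1} :=
    disjoint_filter.2 fun x _ h => h.not_gt
  calc 2 * #(ltPairsBelow v)
      = #(ltPairsBelow v ∪ {x ∈ Iio v ×ˢ Iio v | x.2 < x.1}) := by
        rw [card_union_of_disjoint hdisj, hswap, two_mul]
    _ ≤ #(Iio v ×ˢ Iio v) := card_le_card (union_subset (filter_subset _ _) (filter_subset _ _))
    _ = (v : ℕ) ^ 2 := by rw [card_product, Fin.card_Iio, sq]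

lemma succ_mul_sum_range_pow_le (k n : ℕ) :
    (k + 1) * ∑ m ∈ range n, m ^ k ≤ n ^ (k + 1) := by
  induction n with
  | zero => simp
  | succ n ih =>
    rw [sum_range_succ, mul_add]
    have : (k + 1) * n ^ k + n ^ (k + 1) ≤ (n + 1) ^ (k + 1) := by
      rw [add_pow, sum_range_succ, sum_range_succ]
      simp only [one_pow, mul_one, Nat.choose_self, Nat.choose_succ_self_right, Nat.cast_id]
      rw [mul_comm]
      gcongr
      exact Nat.le_add_left _ _
    omega

/-- Triangles with largest vertex `v`, recorded as `v` and the set of edges. -/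
def triangles (n : ℕ) : Finset (Fin n × Finset (Sym2 (Fin n))) :=
  (univ.sigma fun v : Fin n => ltPairsBelow v).image
    fun ⟨v, a, b⟩ => (v, {s(v, a), s(a, b), s(b, v)})

/-- Four-cycles with largest vertex `v`, recorded as `v` and the set of edges. -/
def fourCycles (n : ℕ) : Finset (Fin n × Finset (Sym2 (Fin n))) :=
  ((univ.sigma fun v : Fin n => ltPairsBelow v ×ˢ Iio v).filter
      fun ⟨_, (a, b), c⟩ => c ≠ a ∧ c ≠ b).image
    fun ⟨v, (a, b), c⟩ => (v, {s(v, a), s(a, c), s(c, b), s(b, v)})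

/-- Five-cycles with largest vertex `v`, recorded as `v` and the set of edges. -/
def fiveCycles (n : ℕ) : Finset (Fin n × Finset (Sym2 (Fin n))) :=
  ((univ.sigma fun v : Fin n => ltPairsBelow v ×ˢ Iio v ×ˢ Iio v).filter
      fun ⟨_, (a, b), c, d⟩ => c ≠ a ∧ d ≠ a ∧ c ≠ d ∧ c ≠ b ∧ d ≠ b).image
    fun ⟨v, (a, b), c, d⟩ => (v, {s(v, a), s(a, c), s(c, d), s(d, b), s(b, v)})

lemma card_edges_of_mem_triangles {n : ℕ} {c : Fin n × Finset (Sym2 (Fin n))}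
    (hc : c ∈ triangles n) : #c.2 = 3 := by
  simp only [triangles, ltPairsBelow, mem_image, mem_sigma, mem_filter, mem_product, mem_Iio] at hc
  obtain ⟨⟨v, a, b⟩, ⟨-, ⟨ha, hb⟩, hab⟩, rfl⟩ := hc
  simp only at ha hb hab
  have := ha.ne
  have := hb.ne
  have := hab.ne
  refine card_eq_three.2 ⟨_, _, _, ?_, ?_, ?_, rfl⟩ <;> grind

lemma card_edges_of_mem_fourCycles {n : ℕ} {c : Fin n × Finset (Sym2 (Fin n))}
    (hc : c ∈ fourCycles n) : #c.2 = 4 := by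
  simp only [fourCycles, ltPairsBelow, mem_image, mem_sigma, mem_filter, mem_product, mem_Iio] at hc
  obtain ⟨⟨v, ⟨a, b⟩, c⟩, ⟨⟨-, ⟨⟨ha, hb⟩, hab⟩, hc⟩, hca, hcb⟩, rfl⟩ := hc
  simp only at ha hb hab hc
  have := ha.ne
  have := hb.ne
  have := hc.ne
  have := hab.ne
  rw [card_insert_of_notMem, card_insert_of_notMem, card_insert_of_notMem, card_singleton]
  all_goals simp only [mem_insert, mem_singleton, Sym2.eq_iff]; grind

lemma card_edges_of_mem_fiveCycles {n : ℕ} {c : Fin n × Finset (Sym2 (Fin n))}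
    (hc : c ∈ fiveCycles n) : #c.2 = 5 := by
  simp only [fiveCycles, ltPairsBelow, mem_image, mem_sigma, mem_filter, mem_product, mem_Iio] at hc
  obtain ⟨⟨v, ⟨a, b⟩, c, d⟩, ⟨⟨-, ⟨⟨ha, hb⟩, hab⟩, hc, hd⟩, hca, hda, hcd, hcb, hdb⟩, rfl⟩ := hc
  simp only at ha hb hab hc hd
  have := ha.ne
  have := hb.ne
  have := hc.ne
  have := hd.ne
  have := hab.ne
  rw [card_insert_of_notMem, card_insert_of_notMem, card_insert_of_notMem,
    card_insert_of_notMem, card_singleton]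
  all_goals simp only [mem_insert, mem_singleton, Sym2.eq_iff]; grind

lemma two_mul_mul_sum_card_ltPairsBelow_le (n k : ℕ) :
    2 * (k + 3) * ∑ v : Fin n, #(ltPairsBelow v) * (v : ℕ) ^ k ≤ n ^ (k + 3) := by
  refine le_trans ?_ (succ_mul_sum_range_pow_le (k + 2) n)
  rw [← Fin.sum_univ_eq_sum_range (fun m => m ^ (k + 2)), mul_comm 2, mul_assoc, mul_sum]
  gcongr with v
  calc 2 * (#(ltPairsBelow v) * (v : ℕ) ^ k) = 2 * #(ltPairsBelow v) * (v : ℕ) ^ k := by ring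
    _ ≤ (v : ℕ) ^ 2 * (v : ℕ) ^ k := by gcongr; exact two_mul_card_ltPairsBelow_le v
    _ = (v : ℕ) ^ (k + 2) := by ring

lemma card_triangles_le (n : ℕ) : 6 * #(triangles n) ≤ n ^ 3 := by
  refine le_trans ?_ (two_mul_mul_sum_card_ltPairsBelow_le n 0)
  refine Nat.mul_le_mul_left 6 (card_image_le.trans (le_of_eq ?_))
  simp

lemma card_fourCycles_le (n : ℕ) : 8 * #(fourCycles n) ≤ n ^ 4 := by
  refine le_trans ?_ (two_mul_mul_sum_card_ltPairsBelow_le n 1)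
  refine Nat.mul_le_mul_left 8 (card_image_le.trans ((card_filter_le _ _).trans (le_of_eq ?_)))
  simp

lemma card_fiveCycles_le (n : ℕ) : 10 * #(fiveCycles n) ≤ n ^ 5 := by
  refine le_trans ?_ (two_mul_mul_sum_card_ltPairsBelow_le n 2)
  refine Nat.mul_le_mul_left 10 (card_image_le.trans ((card_filter_le _ _).trans (le_of_eq ?_)))
  simp [sq]

/-- The cycles of length three, four and five in the complete graph on `Fin n`, recorded as
their largest vertex and their edges. -/
def shortCycles (n : ℕ) : Finset (Fin n × Finset (Sym2 (Fin n))) :=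
  triangles n ∪ (fourCycles n ∪ fiveCycles n)

lemma sum_shortCycles_pow_le (n : ℕ) (p : ℝ) (hp : 0 ≤ p) :
    ∑ c ∈ shortCycles n, p ^ #c.2 ≤
      (n * p) ^ 3 / 6 + (n * p) ^ 4 / 8 + (n * p) ^ 5 / 10 := by
  have hunion (s t : Finset (Fin n × Finset (Sym2 (Fin n)))) :
      ∑ c ∈ s ∪ t, p ^ #c.2 ≤ ∑ c ∈ s, p ^ #c.2 + ∑ c ∈ t, p ^ #c.2 := by
    rw [← sum_union_inter]
    exact le_add_of_nonneg_right (sum_nonneg fun _ _ => by positivity)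
  have h3 : (6 : ℝ) * #(triangles n) ≤ n ^ 3 := by exact_mod_cast card_triangles_le n
  have h4 : (8 : ℝ) * #(fourCycles n) ≤ n ^ 4 := by exact_mod_cast card_fourCycles_le n
  have h5 : (10 : ℝ) * #(fiveCycles n) ≤ n ^ 5 := by exact_mod_cast card_fiveCycles_le n
  have e3 : ∑ c ∈ triangles n, p ^ #c.2 = #(triangles n) * p ^ 3 := by
    rw [sum_congr rfl fun c hc => by rw [card_edges_of_mem_triangles hc], sum_const, nsmul_eq_mul]
  have e4 : ∑ c ∈ fourCycles n, p ^ #c.2 = #(fourCycles n) * p ^ 4 := by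
    rw [sum_congr rfl fun c hc => by rw [card_edges_of_mem_fourCycles hc], sum_const, nsmul_eq_mul]
  have e5 : ∑ c ∈ fiveCycles n, p ^ #c.2 = #(fiveCycles n) * p ^ 5 := by
    rw [sum_congr rfl fun c hc => by rw [card_edges_of_mem_fiveCycles hc], sum_const, nsmul_eq_mul]
  calc ∑ c ∈ shortCycles n, p ^ #c.2
      ≤ #(triangles n) * p ^ 3 + (#(fourCycles n) * p ^ 4 + #(fiveCycles n) * p ^ 5) := by
        rw [← e3, ← e4, ← e5]
        exact (hunion _ _).trans (add_le_add le_rfl (hunion _ _))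
    _ ≤ n ^ 3 / 6 * p ^ 3 + (n ^ 4 / 8 * p ^ 4 + n ^ 5 / 10 * p ^ 5) := by
        gcongr <;> linarith
    _ = _ := by ring

/-- A graph with vertex set `Fin n`, given by its edges, becomes a graph of girth at least six
once the largest vertex of every short cycle is removed. -/
lemma six_le_egirth_comap_fromEdgeSet {n : ℕ} (A : Finset (Sym2 (Fin n))) :
    6 ≤ ((SimpleGraph.fromEdgeSet (A : Set (Sym2 (Fin n)))).comap
      (Subtype.val : {v // v ∉ {c ∈ shortCycles n | c.2 ⊆ A}.image Prod.fst} → Fin n)).egirth := by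
  have hD (v : {v // v ∉ {c ∈ shortCycles n | c.2 ⊆ A}.image Prod.fst})
      (B : Finset (Sym2 (Fin n))) (hB : B ⊆ A) (hv : (v.1, B) ∈ shortCycles n) : False :=
    v.2 (mem_image.2 ⟨(v.1, B), mem_filter.2 ⟨hv, hB⟩, rfl⟩)
  apply six_le_egirth_of_forall_max
  · intro v a b ha hb hab h1 h2 h3
    simp only [SimpleGraph.comap_adj, SimpleGraph.fromEdgeSet_adj, mem_coe] at h1 h2 h3
    refine hD v {s(v.1, a.1), s(a.1, b.1), s(b.1, v.1)} ?_ ?_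
    · simp [insert_subset_iff, h1, h2, h3]
    · refine mem_union_left _ (mem_image.2 ⟨⟨v, a, b⟩, ?_, rfl⟩)
      simp [ltPairsBelow, ha, hb, hab]
  · intro v a c b ha hc hb hab hca hcb h1 h2 h3 h4
    simp only [SimpleGraph.comap_adj, SimpleGraph.fromEdgeSet_adj, mem_coe] at h1 h2 h3 h4
    refine hD v {s(v.1, a.1), s(a.1, c.1), s(c.1, b.1), s(b.1, v.1)} ?_ ?_
    · simp [insert_subset_iff, h1, h2, h3, h4]
    · refine mem_union_right _ (mem_union_left _ (mem_image.2 ⟨⟨v, (a, b), c⟩, ?_, rfl⟩))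
      simp [ltPairsBelow, ha, hb, hab, hc, Subtype.val_inj, hca, hcb]
  · intro v a c d b ha hc hd hb hab hca hda hcd hcb hdb h1 h2 h3 h4 h5
    simp only [SimpleGraph.comap_adj, SimpleGraph.fromEdgeSet_adj, mem_coe] at h1 h2 h3 h4 h5
    refine hD v {s(v.1, a.1), s(a.1, c.1), s(c.1, d.1), s(d.1, b.1), s(b.1, v.1)} ?_ ?_
    · simp [insert_subset_iff, h1, h2, h3, h4, h5]
    · refine mem_union_right _ (mem_union_right _ (mem_image.2 ⟨⟨v, (a, b), c, d⟩, ?_, rfl⟩))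
      simp [ltPairsBelow, ha, hb, hab, hc, hd, Subtype.val_inj, hca, hcb, hda, hcd, hdb]

/-- If every independent set has at most `K` vertices, a `b`-fold coloring with `a` colors
satisfies `|V| b ≤ a K`. -/
lemma card_mul_le_of_fold_coloring {V : Type*} [Fintype V] (G : SimpleGraph V) (K a b : ℕ)
    (hK : ∀ s : Finset V, (∀ u ∈ s, ∀ v ∈ s, ¬ G.Adj u v) → #s ≤ K)
    (f : V → Finset (Fin a)) (hf : ∀ v, #(f v) = b)
    (hG : ∀ u v, G.Adj u v → Disjoint (f u) (f v)) :
    Fintype.card V * b ≤ a * K := by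
  have h := sum_card_bipartiteAbove_eq_sum_card_bipartiteBelow
    (s := (univ : Finset V)) (t := (univ : Finset (Fin a))) (fun v c => c ∈ f v)
  calc Fintype.card V * b = ∑ v : V, #(bipartiteAbove (fun v c => c ∈ f v) univ v) := by
        simp [bipartiteAbove, hf]
    _ = ∑ c : Fin a, #(bipartiteBelow (fun v c => c ∈ f v) univ c) := h
    _ ≤ ∑ _c : Fin a, K := sum_le_sum fun c _ => hK _ fun u hu v hv huv =>
        disjoint_left.1 (hG u v huv) (mem_filter.1 hu).2 (mem_filter.1 hv).2
    _ = a * K := by simp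

/-- The deletion method for girth six: at density `p` the random graph on `n` vertices has few
short cycles and no independent set of size `K`. -/
lemma exists_girth_six_of_first_moment (n K X : ℕ) (p : ℝ) (hp0 : 0 ≤ p) (hp1 : p ≤ 1)
    (hX : 0 < X)
    (h : ((n * p) ^ 3 / 6 + (n * p) ^ 4 / 8 + (n * p) ^ 5 / 10) / X
      + 2 ^ n * (1 - p) ^ K.choose 2 < 1) :
    ∃ (V : Type) (_ : Fintype V) (G : SimpleGraph V),
      Fintype.card V ≤ n ∧ n < Fintype.card V + X ∧ 6 ≤ G.egirth ∧
      ∀ s : Finset V, (∀ u ∈ s, ∀ v ∈ s, ¬ G.Adj u v) → #s ≤ K := by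
  classical
  obtain ⟨A, hA, hI⟩ := exists_finset_few_subset_forall_not_disjoint p hp0 hp1 (shortCycles n)
    Prod.snd (powersetCard K (univ : Finset (Fin n))) (fun J => J.offDiag.image (Function.uncurry Sym2.mk)) X hX <| by
      refine lt_of_le_of_lt (add_le_add ?_ ?_) h
      · gcongr
        exact sum_shortCycles_pow_le n p hp0
      · rw [sum_congr rfl fun J hJ => by
          rw [Sym2.card_image_offDiag, (mem_powersetCard.1 hJ).2], sum_const, nsmul_eq_mul,
          card_powersetCard, card_univ, Fintype.card_fin]
        refine mul_le_mul_of_nonneg_right ?_ (pow_nonneg (sub_nonneg.2 hp1) _)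
        exact_mod_cast Nat.choose_le_two_pow n K
  have hcard : Fintype.card {v // v ∉ {c ∈ shortCycles n | c.2 ⊆ A}.image Prod.fst}
      = n - #({c ∈ shortCycles n | c.2 ⊆ A}.image Prod.fst) := by
    rw [Fintype.card_subtype_compl, Fintype.card_fin, Fintype.card_coe]
  have hD : #({c ∈ shortCycles n | c.2 ⊆ A}.image Prod.fst) < X := card_image_le.trans_lt hA
  refine ⟨_, inferInstance, _, ?_, ?_, six_le_egirth_comap_fromEdgeSet A, ?_⟩
  · omega
  · omega
  · intro s hs
    by_contra! hlt
    obtain ⟨J, hJs, hJK⟩ := exists_subset_card_eq hlt.le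
    refine hI (J.map (Function.Embedding.subtype _)) (by simp [mem_powersetCard, hJK]) ?_
    rw [disjoint_left]
    intro e he heA
    obtain ⟨⟨x, y⟩, hxy, rfl⟩ := mem_image.1 he
    obtain ⟨hx, hy, hne⟩ := mem_offDiag.1 hxy
    obtain ⟨u, hu, rfl⟩ := mem_map.1 hx
    obtain ⟨v, hv, rfl⟩ := mem_map.1 hy
    refine hs u (hJs hu) v (hJs hv) ?_
    rw [SimpleGraph.comap_adj, SimpleGraph.fromEdgeSet_adj]
    exact ⟨heA, hne⟩

/-- A first moment estimate in powers of a large number `m`. -/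
lemma two_pow_mul_one_sub_pow_le (p : ℝ) (hp1 : p ≤ 1) (m N : ℕ) (hm : 100 ≤ m)
    (h : 1.45 * m ≤ p * N) : (2 : ℝ) ^ (2 * m) * (1 - p) ^ N ≤ 1 / 20 := by
  have h1 : (1 - p) ^ N ≤ Real.exp (-1.45) ^ m := by
    calc (1 - p) ^ N ≤ Real.exp (-p) ^ N :=
          pow_le_pow_left₀ (sub_nonneg.2 hp1) (Real.one_sub_le_exp_neg p) N
      _ = Real.exp (-(p * N)) := by rw [← Real.exp_nat_mul]; ring_nf
      _ ≤ Real.exp (m * (-1.45)) := Real.exp_le_exp.2 (by linarith)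
      _ = Real.exp (-1.45) ^ m := Real.exp_nat_mul _ _
  have h2 : 4 * Real.exp (-1.45) ≤ 0.95 := by
    have he : (4.22 : ℝ) ≤ Real.exp 1.45 := by
      refine le_trans ?_ (Real.sum_le_exp_of_nonneg (by norm_num) 7)
      norm_num [sum_range_succ, Nat.factorial]
    rw [Real.exp_neg, ← div_eq_mul_inv, div_le_iff₀ (Real.exp_pos _)]
    linarith
  calc (2 : ℝ) ^ (2 * m) * (1 - p) ^ N ≤ (2 : ℝ) ^ (2 * m) * Real.exp (-1.45) ^ m := by gcongr
    _ = (4 * Real.exp (-1.45)) ^ m := by rw [pow_mul, ← mul_pow]; norm_num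
    _ ≤ 0.95 ^ m := by gcongr
    _ ≤ 0.95 ^ 100 := pow_le_pow_of_le_one (by norm_num) (by norm_num) hm
    _ ≤ 1 / 20 := by norm_num

/-- There exists a simple graph on at most `2×10⁶` vertices with girth at least `6` and
fractional chromatic number at least `3.1`: for every `b`-fold coloring with `a` colors
(an assignment of `b`-element subsets of the `a` colors to the vertices such that adjacent
vertices receive disjoint sets), one has `a/b ≥ 3.1`. -/
theorem exists_girth_six_large_fracchromatic :
    ∃ (V : Type) (_ : Fintype V) (G : SimpleGraph V),
      Fintype.card V ≤ 2 * 10 ^ 6 ∧ 6 ≤ G.egirth ∧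
      ∀ a b : ℕ, 0 < b →
        (∃ f : V → Finset (Fin a),
          (∀ v, (f v).card = b) ∧ ∀ u v, G.Adj u v → Disjoint (f u) (f v)) →
        (3.1 : ℝ) ≤ (a : ℝ) / (b : ℝ) := by
  obtain ⟨m, hm⟩ : ∃ m : ℕ, m = 1000000 := ⟨_, rfl⟩
  obtain ⟨K, hK⟩ : ∃ K : ℕ, K = 606000 := ⟨_, rfl⟩
  have hmR : (m : ℝ) = 1000000 := by rw [hm]; norm_num
  have hKR : (K : ℝ) = 606000 := by rw [hK]; norm_num
  have hind : (2 : ℝ) ^ (2 * m) * (1 - 1 / 125000) ^ K.choose 2 ≤ 1 / 20 := by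
    refine two_pow_mul_one_sub_pow_le _ (by norm_num) m _ (by omega) ?_
    rw [Nat.cast_choose_two, hmR, hKR]
    norm_num
  obtain ⟨V, hV, G, hn, hX, hg, hα⟩ := exists_girth_six_of_first_moment (2 * m) K 120000
    (1 / 125000) (by norm_num) (by norm_num) (by norm_num) <| by
      refine lt_of_le_of_lt (add_le_add_right hind _) ?_
      push_cast
      rw [hmR]
      norm_num
  refine ⟨V, hV, G, by omega, hg, ?_⟩
  rintro a b hb ⟨f, hf, hG⟩
  have hab := card_mul_le_of_fold_coloring G K a b hα f hf hG
  have hVb : 1880000 * b ≤ Fintype.card V * b := Nat.mul_le_mul_right b (by omega)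
  have hb' : (0 : ℝ) < b := by exact_mod_cast hb
  have hab' : (1880000 : ℝ) * b ≤ a * K := by exact_mod_cast hVb.trans hab
  rw [hKR] at hab'
  rw [le_div_iff₀ hb']
  linarith
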